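/- (Consistency of BF when ε = 0.) Take b = b* = A η and ε = 0, and suppose σ, σ' ∈ ℝ^m with σ, σ' ≥ 0 attain the supremum of the dual objective (σ'−σ)·b* − Σ_i log( Σ_ℓ exp(a^{(σ'−σ)}_{iℓ}) ) over nonnegative pairs. Then, writing θ = σ' − σ, one has A g^{(θ)} = A η, and g^{(θ)} is the best approximator of η in the exponential family: d(η, g^{(θ)}) ≤ d(η, g^{(θ')}) for every θ' ∈ ℝ^m. -/

import Mathlib

open Finset

attribute [local instance] Classical.propDecidable

noncomputable section

/-- The simplex `Δ_k^n`: rows are probability distributions over `Fin k`. -/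
def Simplex (n k : ℕ) : Set (Fin n → Fin k → ℝ) :=
  {z | (∀ i ℓ, 0 ≤ z i ℓ) ∧ ∀ i, ∑ ℓ, z i ℓ = 1}

/-- Number of points where rule `j` does not abstain. -/
def nRule {n k p : ℕ} (h : Fin p → Fin n → Option (Fin k)) (j : Fin p) : ℕ :=
  (Finset.univ.filter (fun i => h j i ≠ none)).card

/-- The constraint matrix `A`, with `m = p + k` rows indexed by `Fin p ⊕ Fin k`. -/
def Amat {n k p : ℕ} (h : Fin p → Fin n → Option (Fin k)) :
    Fin p ⊕ Fin k → Fin n → Fin k → ℝ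
  | Sum.inl j => fun i ℓ => if h j i = some ℓ then 1 / (nRule h j : ℝ) else 0
  | Sum.inr ℓ' => fun i ℓ => if ℓ = ℓ' then 1 / (n : ℝ) else 0

/-- `(A z)_j`. -/
def applyA {n k p : ℕ} (h : Fin p → Fin n → Option (Fin k))
    (z : Fin n → Fin k → ℝ) (j : Fin p ⊕ Fin k) : ℝ :=
  ∑ i, ∑ ℓ, Amat h j i ℓ * z i ℓ

/-- The polytope `P(b, ε)`. -/
def Polytope {n k p : ℕ} (h : Fin p → Fin n → Option (Fin k))
    (b ε : Fin p ⊕ Fin k → ℝ) : Set (Fin n → Fin k → ℝ) :=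
  {z | z ∈ Simplex n k ∧ ∀ j, b j - ε j ≤ applyA h z j ∧ applyA h z j ≤ b j + ε j}

/-- Extended-real logarithm, with `elog 0 = ⊥ = -∞`. -/
def elog (x : ℝ) : EReal := if x = 0 then ⊥ else ((Real.log x : ℝ) : EReal)

/-- `z · log g`, valued in `[-∞, 0]` with the convention `0 · log 0 = 0`. -/
def dotlog {n k : ℕ} (z g : Fin n → Fin k → ℝ) : EReal :=
  ∑ i, ∑ ℓ, (z i ℓ : EReal) * elog (g i ℓ)

/-- `a^{(θ)}_{iℓ} = Σ_j θ_j · A j i ℓ`. -/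
def avec {n k p : ℕ} (h : Fin p → Fin n → Option (Fin k))
    (θ : Fin p ⊕ Fin k → ℝ) (i : Fin n) (ℓ : Fin k) : ℝ :=
  ∑ j, θ j * Amat h j i ℓ

/-- The exponential-family (softmax) prediction `g^{(θ)}`. -/
def gexp {n k p : ℕ} (h : Fin p → Fin n → Option (Fin k))
    (θ : Fin p ⊕ Fin k → ℝ) (i : Fin n) (ℓ : Fin k) : ℝ :=
  Real.exp (avec h θ i ℓ) / ∑ ℓ', Real.exp (avec h θ i ℓ')

/-- The BF dual objective `(σ'−σ)·b − (σ'+σ)·ε − Σ_i log(Σ_ℓ exp(a^{(σ'−σ)}_{iℓ}))`. -/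
def dualObj {n k p : ℕ} (h : Fin p → Fin n → Option (Fin k))
    (b ε σ σ' : Fin p ⊕ Fin k → ℝ) : ℝ :=
  (∑ j, (σ' j - σ j) * b j) - (∑ j, (σ' j + σ j) * ε j)
    - ∑ i, Real.log (∑ ℓ, Real.exp (avec h (fun j => σ' j - σ j) i ℓ))

/-- KL summand `a·log(a/c)`, with `0·log(0/c) = 0` and `a·log(a/0) = ⊤` for `a ≠ 0`. -/
def klTerm (a c : ℝ) : EReal :=
  if a = 0 then 0 else if c = 0 then ⊤ else ((a * Real.log (a / c) : ℝ) : EReal)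

/-- `d(μ, ν)`, the summed KL divergences, valued in `[0, +∞]`. -/
def dKL {n k : ℕ} (μ ν : Fin n → Fin k → ℝ) : EReal :=
  ∑ i, ∑ ℓ, klTerm (μ i ℓ) (ν i ℓ)

/-- Unnormalized one-coin Dawid–Skene score `N_{iℓ}`. -/
def Nds {n k p : ℕ} (h : Fin p → Fin n → Option (Fin k))
    (w : Fin k → ℝ) (β : Fin p → ℝ) (i : Fin n) (ℓ : Fin k) : ℝ :=
  w ℓ * (∏ j ∈ Finset.univ.filter (fun j => h j i = some ℓ), β j)
    * ∏ j ∈ Finset.univ.filter (fun j => ∃ ℓ' ≠ ℓ, h j i = some ℓ'),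
        (1 - β j) / ((k : ℝ) - 1)

/-- The one-coin Dawid–Skene prediction `g^{ds}(w, β)`. -/
def gds {n k p : ℕ} (h : Fin p → Fin n → Option (Fin k))
    (w : Fin k → ℝ) (β : Fin p → ℝ) (i : Fin n) (ℓ : Fin k) : ℝ :=
  Nds h w β i ℓ / ∑ ℓ', Nds h w β i ℓ'

/-- The log-likelihood `θ·(A η) − Σ_i log(Σ_ℓ exp(a^{(θ)}_{iℓ}))` of the exponential family. -/
def logLik {n k p : ℕ} (h : Fin p → Fin n → Option (Fin k)) (η : Fin n → Fin k → ℝ)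
    (θ : Fin p ⊕ Fin k → ℝ) : ℝ :=
  ∑ j, θ j * applyA h η j - ∑ i, Real.log (∑ ℓ, Real.exp (avec h θ i ℓ))

lemma sum_exp_pos {k : ℕ} (hk : 0 < k) (f : Fin k → ℝ) : 0 < ∑ ℓ, Real.exp (f ℓ) :=
  Finset.sum_pos (fun _ _ => Real.exp_pos _) ⟨⟨0, hk⟩, Finset.mem_univ _⟩

lemma gexp_pos {n k p : ℕ} (hk : 0 < k) (h : Fin p → Fin n → Option (Fin k))
    (θ : Fin p ⊕ Fin k → ℝ) (i : Fin n) (ℓ : Fin k) : 0 < gexp h θ i ℓ :=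
  div_pos (Real.exp_pos _) (sum_exp_pos hk _)

lemma log_gexp {n k p : ℕ} (hk : 0 < k) (h : Fin p → Fin n → Option (Fin k))
    (θ : Fin p ⊕ Fin k → ℝ) (i : Fin n) (ℓ : Fin k) :
    Real.log (gexp h θ i ℓ) = avec h θ i ℓ - Real.log (∑ ℓ', Real.exp (avec h θ i ℓ')) := by
  rw [gexp, Real.log_div (Real.exp_pos _).ne' (sum_exp_pos hk _).ne', Real.log_exp]

lemma dualObj_zero_right {n k p : ℕ} (h : Fin p → Fin n → Option (Fin k))
    (η : Fin n → Fin k → ℝ) (σ σ' : Fin p ⊕ Fin k → ℝ) :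
    dualObj h (applyA h η) 0 σ σ' = logLik h η (fun j => σ' j - σ j) := by
  simp [dualObj, logLik]

lemma sum_mul_applyA {n k p : ℕ} (h : Fin p → Fin n → Option (Fin k))
    (η : Fin n → Fin k → ℝ) (θ : Fin p ⊕ Fin k → ℝ) :
    ∑ j, θ j * applyA h η j = ∑ i, ∑ ℓ, η i ℓ * avec h θ i ℓ := by
  simp only [applyA, avec, Finset.mul_sum]
  rw [Finset.sum_comm]
  refine Finset.sum_congr rfl fun i _ => ?_
  rw [Finset.sum_comm]
  refine Finset.sum_congr rfl fun ℓ _ => Finset.sum_congr rfl fun j _ => ?_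
  ring

lemma klTerm_of_pos {a c : ℝ} (hc : 0 < c) :
    klTerm a c = ((a * Real.log a - a * Real.log c : ℝ) : EReal) := by
  by_cases ha : a = 0
  · simp [klTerm, ha]
  · rw [klTerm, if_neg ha, if_neg hc.ne', Real.log_div ha hc.ne', mul_sub]

lemma ereal_coe_sum {ι : Type*} (s : Finset ι) (f : ι → ℝ) :
    ((∑ i ∈ s, f i : ℝ) : EReal) = ∑ i ∈ s, (f i : EReal) :=
  map_sum (⟨⟨Real.toEReal, EReal.coe_zero⟩, EReal.coe_add⟩ : ℝ →+ EReal) f s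

/-- The divergence to a member of the exponential family is the negative entropy minus the
log-likelihood. -/
lemma dKL_gexp {n k p : ℕ} (hk : 0 < k) (h : Fin p → Fin n → Option (Fin k))
    {η : Fin n → Fin k → ℝ} (hη : η ∈ Simplex n k) (θ : Fin p ⊕ Fin k → ℝ) :
    dKL η (gexp h θ)
      = ((∑ i, ∑ ℓ, η i ℓ * Real.log (η i ℓ) - logLik h η θ : ℝ) : EReal) := by
  simp only [dKL, klTerm_of_pos (gexp_pos hk h θ _ _), ← ereal_coe_sum, log_gexp hk]
  congr 1
  rw [logLik, sum_mul_applyA]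
  simp only [mul_sub, Finset.sum_sub_distrib, ← Finset.sum_mul, hη.2, one_mul]

lemma avec_add_single {n k p : ℕ} (h : Fin p → Fin n → Option (Fin k))
    (θ : Fin p ⊕ Fin k → ℝ) (j : Fin p ⊕ Fin k) (t : ℝ) (i : Fin n) (ℓ : Fin k) :
    avec h (θ + Pi.single j t) i ℓ = avec h θ i ℓ + t * Amat h j i ℓ := by
  simp [avec, add_mul, Finset.sum_add_distrib, Pi.single_apply, ite_mul]

/-- The gradient of the log-likelihood is the moment discrepancy `A η − A g^{(θ)}`. -/
lemma hasDerivAt_logLik_add_single {n k p : ℕ} (hk : 0 < k)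
    (h : Fin p → Fin n → Option (Fin k)) (η : Fin n → Fin k → ℝ)
    (θ : Fin p ⊕ Fin k → ℝ) (j : Fin p ⊕ Fin k) :
    HasDerivAt (fun t : ℝ => logLik h η (θ + Pi.single j t))
      (applyA h η j - applyA h (gexp h θ) j) 0 := by
  have hlin : HasDerivAt (fun t : ℝ =>
        ∑ j', (θ + Pi.single j t : Fin p ⊕ Fin k → ℝ) j' * applyA h η j')
      (applyA h η j) 0 := by
    have : (fun t : ℝ =>
        ∑ j', (θ + Pi.single j t : Fin p ⊕ Fin k → ℝ) j' * applyA h η j')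
        = fun t => ∑ j', θ j' * applyA h η j' + t * applyA h η j := by
      ext t
      simp only [Pi.add_apply, add_mul, Finset.sum_add_distrib, Pi.single_apply, ite_mul, zero_mul,
        Finset.sum_ite_eq', Finset.mem_univ, if_true]
    rw [this]
    simpa using ((hasDerivAt_id (0 : ℝ)).mul_const (applyA h η j)).const_add
      (∑ j', θ j' * applyA h η j')
  have hlog : ∀ i, HasDerivAt
      (fun t : ℝ => Real.log (∑ ℓ, Real.exp (avec h (θ + Pi.single j t) i ℓ)))
      (∑ ℓ, Amat h j i ℓ * gexp h θ i ℓ) 0 := by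
    intro i
    simp only [avec_add_single]
    have hexp : ∀ ℓ ∈ (Finset.univ : Finset (Fin k)),
        HasDerivAt (fun t : ℝ => Real.exp (avec h θ i ℓ + t * Amat h j i ℓ))
          (Real.exp (avec h θ i ℓ) * Amat h j i ℓ) 0 := by
      intro ℓ _
      simpa using (((hasDerivAt_id (0 : ℝ)).mul_const (Amat h j i ℓ)).const_add
        (avec h θ i ℓ)).exp
    convert (HasDerivAt.fun_sum hexp).log (sum_exp_pos hk _).ne' using 1
    simp only [zero_mul, add_zero, Finset.sum_div, gexp]
    refine Finset.sum_congr rfl fun ℓ _ => ?_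
    ring
  exact hlin.sub (HasDerivAt.fun_sum fun i _ => hlog i)

/-- consistency of BF when `ε = 0`: the dual optimizer yields the
best approximator of `η` in the exponential family. -/
theorem stmt6 {n k p : ℕ} (hn : 0 < n) (hk : 2 ≤ k) (hp : 0 < p)
    (h : Fin p → Fin n → Option (Fin k)) (hnj : ∀ j, 0 < nRule h j)
    (η : Fin n → Fin k → ℝ) (hη : η ∈ Simplex n k)
    (σ σ' : Fin p ⊕ Fin k → ℝ) (hσ : ∀ j, 0 ≤ σ j) (hσ' : ∀ j, 0 ≤ σ' j)
    (hopt : ∀ τ τ' : Fin p ⊕ Fin k → ℝ, (∀ j, 0 ≤ τ j) → (∀ j, 0 ≤ τ' j) →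
      dualObj h (applyA h η) 0 τ τ' ≤ dualObj h (applyA h η) 0 σ σ') :
    (∀ j, applyA h (gexp h (fun j => σ' j - σ j)) j = applyA h η j)
    ∧ ∀ θ' : Fin p ⊕ Fin k → ℝ,
        dKL η (gexp h (fun j => σ' j - σ j)) ≤ dKL η (gexp h θ') := by
  have hk0 : 0 < k := by omega
  have hmax : ∀ θ, logLik h η θ ≤ logLik h η (fun j => σ' j - σ j) := by
    intro θ
    have := hopt (fun j => (θ j)⁻) (fun j => (θ j)⁺) (fun j => negPart_nonneg _)
      (fun j => posPart_nonneg _)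
    simpa only [dualObj_zero_right, posPart_sub_negPart] using this
  refine ⟨fun j => ?_, fun θ' => ?_⟩
  · have hloc : IsLocalMax
        (fun t : ℝ => logLik h η ((fun j => σ' j - σ j) + Pi.single j t)) 0 :=
      Filter.Eventually.of_forall fun t => by simpa using hmax _
    linarith [hloc.hasDerivAt_eq_zero (hasDerivAt_logLik_add_single hk0 h η _ j)]
  · rw [dKL_gexp hk0 h hη, dKL_gexp hk0 h hη, EReal.coe_le_coe_iff]
    linarith [hmax θ']
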